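/- Let $a, b \ge 0$ with $a + b < 1$. Then $\int_0^{2\pi} \frac{(1 - a\cos t)\, dt}{((1 - a\cos t)^2 - b^2)^{3/2}} = \frac{4\, E\left(\sqrt{4ab/(1-(a-b)^2)}\right)}{(1-(a-b)^2)^{1/2}\,(1-(a+b)^2)}$, where $E(k) = \int_0^{\pi/2}\sqrt{1 - k^2\sin^2\theta}\, d\theta$. -/

import Mathlib

/-- The algebraic identity behind the reduction to a complete integral of the second kind. -/
lemma aux_alg (a b r w c s D W : ℝ) (hq : 0 < 1 - b - a) (hp : 0 < 1 - b + a)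
    (hm : 0 < 1 + b - a) (hl : 0 < 1 + b + a)
    (hr : 0 < r) (hr2 : r ^ 2 = (1 - b + a) * (1 - b - a)) (hw : 0 < w) (hw2 : w ^ 2 = W)
    (hcs : s ^ 2 + c ^ 2 = 1)
    (hD : D = (1 - b + a) * c ^ 2 + (1 - b - a) * s ^ 2) (hD0 : 0 < D)
    (hW : W = (1 - (a - b) ^ 2) - 4 * a * b * s ^ 2) :
    (r ^ 2 + b * D) / D / ((r * w / D) ^ 2 * (r * w / D)) * (2 * r / D)
      = 2 * w / ((1 - (a - b) ^ 2) * (1 - (a + b) ^ 2))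
        + 2 * a / ((1 + b - a) * (1 + b + a)) *
          ((c ^ 2 - s ^ 2) / w + 4 * a * b * s ^ 2 * c ^ 2 / (w ^ 2 * w)) := by
  have hM : 1 - (a - b) ^ 2 = (1 + b - a) * (1 - b + a) := by ring
  have hL : 1 - (a + b) ^ 2 = (1 + b + a) * (1 - b - a) := by ring
  have h1 : (r ^ 2 + b * D) / D / ((r * w / D) ^ 2 * (r * w / D)) * (2 * r / D)
      = 2 * (r ^ 2 + b * D) * D / (r ^ 2 * w ^ 3) := by
    field_simp
  rw [h1, hM, hL, hr2]
  have h2 : c ^ 2 = 1 - s ^ 2 := by linarith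
  have hw4 : w ^ 4 = W ^ 2 := by rw [← hw2]; ring
  rw [div_add' _ _ _ (by positivity)]
  field_simp
  rw [hw4, hw2, hW, hD, h2]
  ring

theorem stmt_9 (a b : ℝ) (ha : 0 ≤ a) (hb : 0 ≤ b) (hab : a + b < 1)
    (E : ℝ → ℝ)
    (hE : ∀ k : ℝ, E k = ∫ θ in (0:ℝ)..(Real.pi / 2), Real.sqrt (1 - k^2 * Real.sin θ ^ 2)) :
    ∫ t in (0:ℝ)..(2 * Real.pi),
        (1 - a * Real.cos t) / ((1 - a * Real.cos t)^2 - b^2) ^ ((3:ℝ)/2)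
      = 4 * E (Real.sqrt (4 * a * b / (1 - (a - b)^2)))
        / ((1 - (a - b)^2) ^ ((1:ℝ)/2) * (1 - (a + b)^2)) := by
  have hq : 0 < 1 - b - a := by linarith
  have hp : 0 < 1 - b + a := by linarith
  have hm : 0 < 1 + b - a := by linarith
  have hl : 0 < 1 + b + a := by linarith
  have hM : 0 < 1 - (a - b) ^ 2 := by nlinarith [mul_pos hm hp]
  have hL : 0 < 1 - (a + b) ^ 2 := by nlinarith [mul_pos hl hq]
  have rpow32 : ∀ x : ℝ, 0 < x → x ^ ((3:ℝ)/2) = √x ^ 2 * √x := by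
    intro x hx
    rw [Real.sq_sqrt hx.le, Real.sqrt_eq_rpow, ← Real.rpow_one_add' hx.le (by norm_num)]
    norm_num
  set f : ℝ → ℝ := fun t =>
    (1 - a * Real.cos t) / ((1 - a * Real.cos t)^2 - b^2) ^ ((3:ℝ)/2) with hf
  have hPpos : ∀ t : ℝ, 0 < (1 - a * Real.cos t)^2 - b^2 := by
    intro t
    have h1 : a * Real.cos t ≤ a := by nlinarith [Real.cos_le_one t]
    have : 0 < (1 - a * Real.cos t - b) * (1 - a * Real.cos t + b) :=
      mul_pos (by linarith) (by linarith)
    nlinarith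
  have hfc : Continuous f := by
    refine Continuous.div (by fun_prop) ?_ (fun t => (Real.rpow_pos_of_pos (hPpos t) _).ne')
    exact Continuous.rpow_const (by fun_prop) (fun t => Or.inl (hPpos t).ne')
  -- halving
  have hhalf : ∫ t in (0:ℝ)..(2 * Real.pi), f t = 2 * ∫ t in (0:ℝ)..Real.pi, f t := by
    rw [← intervalIntegral.integral_add_adjacent_intervals
      (hfc.intervalIntegrable 0 Real.pi) (hfc.intervalIntegrable Real.pi (2 * Real.pi))]
    have : ∫ t in (0:ℝ)..Real.pi, f (2 * Real.pi - t) = ∫ t in Real.pi..(2*Real.pi), f t := by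
      rw [intervalIntegral.integral_comp_sub_left]
      congr 1 <;> ring
    rw [← this]
    have h2 : ∀ t, f (2 * Real.pi - t) = f t := by
      intro t; simp only [hf, Real.cos_two_pi_sub]
    simp only [h2]; ring
  -- notation
  set r := √((1 - b + a) * (1 - b - a)) with hrdef
  have hr : 0 < r := Real.sqrt_pos.2 (mul_pos hp hq)
  have hr2 : r ^ 2 = (1 - b + a) * (1 - b - a) := Real.sq_sqrt (mul_pos hp hq).le
  set D : ℝ → ℝ := fun θ => (1 - b + a) * Real.cos θ ^ 2 + (1 - b - a) * Real.sin θ ^ 2 with hD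
  set W : ℝ → ℝ := fun θ => (1 - (a - b) ^ 2) - 4 * a * b * Real.sin θ ^ 2 with hW
  have hDpos : ∀ θ, 0 < D θ := by
    intro θ
    have h := Real.sin_sq_add_cos_sq θ
    have : D θ = (1 - b - a) + 2 * a * Real.cos θ ^ 2 := by
      simp only [hD]; rw [Real.sin_sq]; ring
    rw [this]; positivity
  have hWpos : ∀ θ, 0 < W θ := by
    intro θ
    have : W θ = (1 - (a + b) ^ 2) + 4 * a * b * Real.cos θ ^ 2 := by
      simp only [hW]; rw [Real.sin_sq]; ring
    rw [this]; positivity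
  have hDc : Continuous D := by simp only [hD]; fun_prop
  have hWc : Continuous W := by simp only [hW]; fun_prop
  set X : ℝ → ℝ := fun θ =>
    ((1 - b + a) * Real.cos θ ^ 2 - (1 - b - a) * Real.sin θ ^ 2) / D θ with hX
  have hXc : Continuous X := Continuous.div (by fun_prop) hDc (fun θ => (hDpos θ).ne')
  have hXle : ∀ θ, X θ ≤ 1 := by
    intro θ
    rw [hX, div_le_one (hDpos θ)]
    have : 0 ≤ (1 - b - a) * Real.sin θ ^ 2 := by positivity
    simp only [hD]; linarith
  have hXge : ∀ θ, -1 ≤ X θ := by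
    intro θ
    rw [hX, le_div_iff₀ (hDpos θ)]
    have : 0 ≤ (1 - b + a) * Real.cos θ ^ 2 := by positivity
    simp only [hD]; linarith
  set T : ℝ → ℝ := fun θ => Real.arccos (X θ) with hT
  have hTc : Continuous T := Real.continuous_arccos.comp hXc
  have hcosT : ∀ θ, Real.cos (T θ) = X θ := fun θ => Real.cos_arccos (hXge θ) (hXle θ)
  have hT0 : T 0 = 0 := by
    simp only [hT, hX, hD]
    simp [div_self hp.ne']
  have hT1 : T (Real.pi / 2) = Real.pi := by
    simp only [hT, hX, hD]
    simp
    rw [div_le_iff₀ hq]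
    linarith
  have hTd : ∀ θ ∈ Set.Ioo (0:ℝ) (Real.pi / 2), HasDerivAt T (2 * r / D θ) θ := by
    intro θ hθ
    have hs : 0 < Real.sin θ := Real.sin_pos_of_pos_of_lt_pi hθ.1 (by linarith [hθ.2, Real.pi_pos])
    have hc : 0 < Real.cos θ := Real.cos_pos_of_mem_Ioo ⟨by linarith [hθ.1, Real.pi_pos], hθ.2⟩
    have hD0 := hDpos θ
    have hcs := Real.sin_sq_add_cos_sq θ
    have hsq : 1 - X θ ^ 2 = (2 * r * Real.cos θ * Real.sin θ / D θ) ^ 2 := by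
      have : (2 * r * Real.cos θ * Real.sin θ / D θ) ^ 2
        = 4 * ((1 - b + a) * (1 - b - a)) * Real.cos θ ^ 2 * Real.sin θ ^ 2 / D θ ^ 2 := by
        rw [← hr2]; ring
      rw [this]
      simp only [hX]
      field_simp
      simp only [hD]
      ring
    have hpos : 0 < 2 * r * Real.cos θ * Real.sin θ / D θ := by positivity
    have hne1 : X θ ≠ -1 := by
      intro h; rw [h] at hsq; nlinarith [pow_pos hpos 2]
    have hne2 : X θ ≠ 1 := by
      intro h; rw [h] at hsq; nlinarith [pow_pos hpos 2]
    have hdX : HasDerivAt X (-(4 * r ^ 2 * Real.cos θ * Real.sin θ / D θ ^ 2)) θ := by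
      have hc2 := ((Real.hasDerivAt_cos θ).pow 2)
      have hs2 := ((Real.hasDerivAt_sin θ).pow 2)
      have hn := (hc2.const_mul (1 - b + a)).sub (hs2.const_mul (1 - b - a))
      have hd := (hc2.const_mul (1 - b + a)).add (hs2.const_mul (1 - b - a))
      have := hn.div hd hD0.ne'
      refine this.congr_deriv ?_
      have e : ((fun y => (1 - b + a) * (Real.cos ^ 2) y) + fun y => (1 - b - a) * (Real.sin ^ 2) y) θ = D θ := by
        simp [hD]
      rw [e, hr2, ← neg_div]
      congr 1
      simp [hD]
      have h2 : Real.cos θ ^ 2 = 1 - Real.sin θ ^ 2 := by linarith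
      linear_combination (-4 * (1 - b + a) * (1 - b - a) * Real.cos θ * Real.sin θ) * hcs
    have := (Real.hasDerivAt_arccos hne1 hne2).comp θ hdX
    refine this.congr_deriv ?_
    rw [hsq, Real.sqrt_sq hpos.le]
    field_simp
    ring
  have hsub : ∫ t in (0:ℝ)..Real.pi, f t
      = ∫ θ in (0:ℝ)..(Real.pi / 2), f (T θ) * (2 * r / D θ) := by
    have hpi : (0:ℝ) ≤ Real.pi / 2 := by positivity
    have := intervalIntegral.integral_comp_mul_deriv'' (a := 0) (b := Real.pi / 2)
      (f := T) (f' := fun θ => 2 * r / D θ) (g := f) hTc.continuousOn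
      (by
        intro θ hθ
        rw [min_eq_left hpi, max_eq_right hpi] at hθ
        exact (hTd θ hθ).hasDerivWithinAt)
      (Continuous.continuousOn (Continuous.div continuous_const hDc (fun θ => (hDpos θ).ne')))
      hfc.continuousOn
    rw [hT0, hT1] at this
    rw [← this]; rfl
  set G' : ℝ → ℝ := fun θ => (Real.cos θ ^ 2 - Real.sin θ ^ 2) / √(W θ)
    + 4 * a * b * Real.sin θ ^ 2 * Real.cos θ ^ 2 / (√(W θ) ^ 2 * √(W θ)) with hG'
  have hpt : ∀ θ, f (T θ) * (2 * r / D θ)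
      = 2 * √(W θ) / ((1 - (a - b) ^ 2) * (1 - (a + b) ^ 2))
        + 2 * a / ((1 + b - a) * (1 + b + a)) * G' θ := by
    intro θ
    have hD0 := hDpos θ
    have hcs := Real.sin_sq_add_cos_sq θ
    have h2 : Real.cos θ ^ 2 = 1 - Real.sin θ ^ 2 := by linarith
    have hw : 0 < √(W θ) := Real.sqrt_pos.2 (hWpos θ)
    have hw2 : √(W θ) ^ 2 = W θ := Real.sq_sqrt (hWpos θ).le
    have e1 : 1 - a * X θ = (r ^ 2 + b * D θ) / D θ := by
      rw [eq_div_iff hD0.ne', hr2]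
      simp only [hX]
      field_simp
      simp only [hD, h2]
      ring
    have e2 : (1 - a * X θ) ^ 2 - b ^ 2 = (r * √(W θ) / D θ) ^ 2 := by
      have : (r * √(W θ) / D θ) ^ 2 = r ^ 2 * W θ / D θ ^ 2 := by
        rw [div_pow, mul_pow, hw2]
      rw [this, e1]
      have e3 : r ^ 2 + 2 * b * D θ = W θ := by
        rw [hr2]; simp only [hD, hW, h2]; ring
      rw [← e3]
      field_simp
      ring
    have e4 : f (T θ) = (r ^ 2 + b * D θ) / D θ
        / ((r * √(W θ) / D θ) ^ 2 * (r * √(W θ) / D θ)) := by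
      have hpos : 0 < r * √(W θ) / D θ := by positivity
      simp only [hf]
      rw [rpow32 _ (hPpos _), hcosT, e2, Real.sqrt_sq hpos.le, e1]
    rw [e4]
    exact aux_alg a b r _ _ _ _ _ hq hp hm hl hr hr2 hw hw2 hcs rfl hD0 rfl
  have hsc : Continuous fun θ => √(W θ) := Real.continuous_sqrt.comp hWc
  have hG'c : Continuous G' := by
    have hw : ∀ θ, √(W θ) ≠ 0 := fun θ => (Real.sqrt_pos.2 (hWpos θ)).ne'
    refine Continuous.add (Continuous.div (by fun_prop) hsc hw) ?_
    exact Continuous.div (by fun_prop) (by fun_prop)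
      (fun θ => mul_ne_zero (pow_ne_zero _ (hw θ)) (hw θ))
  have hGint : ∫ θ in (0:ℝ)..(Real.pi / 2), G' θ = 0 := by
    have hd : ∀ θ, HasDerivAt (fun θ => Real.sin θ * Real.cos θ / √(W θ)) (G' θ) θ := by
      intro θ
      have hw : 0 < √(W θ) := Real.sqrt_pos.2 (hWpos θ)
      have hWd : HasDerivAt W (-(4 * a * b * (2 * Real.sin θ * Real.cos θ))) θ := by
        have := (((Real.hasDerivAt_sin θ).pow 2).const_mul (4 * a * b)).const_sub (1 - (a - b) ^ 2)
        refine this.congr_deriv ?_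
        norm_num
      have := ((Real.hasDerivAt_sin θ).mul (Real.hasDerivAt_cos θ)).div
        (hWd.sqrt (hWpos θ).ne') hw.ne'
      refine this.congr_deriv ?_
      simp only [hG', Pi.mul_apply]
      field_simp
      ring
    rw [intervalIntegral.integral_eq_sub_of_hasDerivAt (fun θ _ => hd θ)
      (hG'c.intervalIntegrable _ _)]
    simp
  have hEW : E (Real.sqrt (4 * a * b / (1 - (a - b)^2)))
      = (∫ θ in (0:ℝ)..(Real.pi / 2), √(W θ)) / √(1 - (a - b) ^ 2) := by
    rw [hE, ← intervalIntegral.integral_div]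
    congr 1
    ext θ
    rw [Real.sq_sqrt (by positivity), ← Real.sqrt_div (hWpos θ).le]
    congr 1
    simp only [hW]
    field_simp
  rw [hhalf, hsub]
  simp only [hpt]
  rw [intervalIntegral.integral_add, intervalIntegral.integral_const_mul, hGint, hEW,
    ← Real.sqrt_eq_rpow, intervalIntegral.integral_div, intervalIntegral.integral_const_mul]
  · have hsM : 0 < √(1 - (a - b) ^ 2) := Real.sqrt_pos.2 hM
    have hsM2 : √(1 - (a - b) ^ 2) ^ 2 = 1 - (a - b) ^ 2 := Real.sq_sqrt hM.le
    set I := ∫ θ in (0:ℝ)..(Real.pi / 2), √(W θ)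
    have : 4 * (I / √(1 - (a - b) ^ 2)) / (√(1 - (a - b) ^ 2) * (1 - (a + b) ^ 2))
      = 4 * I / (√(1 - (a - b) ^ 2) ^ 2 * (1 - (a + b) ^ 2)) := by
      field_simp
    rw [this, hsM2]
    ring
  · exact Continuous.intervalIntegrable (by fun_prop) _ _
  · exact Continuous.intervalIntegrable (by fun_prop) _ _
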